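/- Let k be a field, g ≥ 0 and s ≥ 0. For i = 1, …, g let A_i = !![λ_i, α_i; 0, λ_i⁻¹] and B_i = !![μ_i, β_i; 0, μ_i⁻¹], and for k = 1, …, s let P_k = !![ϑ_k, c_k; 0, ϑ_k⁻¹], all in SL₂(k), with λ_i, μ_i, ϑ_k ∈ kˣ and α_i, β_i, c_k ∈ k. Then ∏_{i=1}^{g} [A_i,B_i] · ∏_{k=1}^{s} P_k equals the identity matrix if and only if ∏_{k=1}^{s} ϑ_k = 1 and Σ_{i=1}^{g} ( μ_i β_i (λ_i² − 1) + λ_i α_i (1 − μ_i²) ) + Σ_{k=1}^{s} (∏_{j<k} ϑ_j) · c_k · (∏_{j>k} ϑ_j)⁻¹ = 0. These are the defining equations of the tuples of upper-triangular matrices lying in the parabolic SL₂(k)-representation variety of a genus g surface with s punctures. -/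

import Mathlib

theorem commutator_upperTriangular {k : Type*} [Field k] (l m : kˣ) (a b : k) :
    (!![(l : k), a; 0, (l⁻¹ : kˣ)] * !![(m : k), b; 0, (m⁻¹ : kˣ)] *
        (!![(l : k), a; 0, (l⁻¹ : kˣ)])⁻¹ * (!![(m : k), b; 0, (m⁻¹ : kˣ)])⁻¹ :
      Matrix (Fin 2) (Fin 2) k) =
    !![1, (m : k) * b * ((l : k) ^ 2 - 1) + (l : k) * a * (1 - (m : k) ^ 2); 0, 1] := by
  have hl : (l : k) ≠ 0 := l.ne_zero
  have hm : (m : k) ≠ 0 := m.ne_zero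
  have inv_eq : ∀ (u : kˣ) (x : k), (!![(u : k), x; 0, (u⁻¹ : kˣ)])⁻¹ =
      !![((u⁻¹ : kˣ) : k), -x; 0, (u : k)] := fun u x =>
    Matrix.inv_eq_right_inv (by simp [Matrix.one_fin_two, mul_comm])
  rw [inv_eq, inv_eq]
  simp only [Matrix.mul_fin_two, Units.val_inv_eq_inv_val]
  generalize (l : k) = x at hl
  generalize (m : k) = y at hm
  ext i j
  fin_cases i <;> fin_cases j <;> simp <;> field_simp
  ring

theorem prod_ofFn_unipotent {k : Type*} [Field k] (g : ℕ) (x : Fin g → k) :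
    (List.ofFn fun i => (!![1, x i; 0, 1] : Matrix (Fin 2) (Fin 2) k)).prod =
      !![1, ∑ i, x i; 0, 1] := by
  induction g with
  | zero => simp [Matrix.one_fin_two]
  | succ n ih => simp [List.ofFn_succ, ih, Fin.sum_univ_succ, add_comm]

theorem prod_ofFn_upperTriangular {k : Type*} [Field k] (s : ℕ) (th : Fin s → kˣ)
    (c : Fin s → k) :
    (List.ofFn fun j => (!![(th j : k), c j; 0, ((th j)⁻¹ : kˣ)] :
        Matrix (Fin 2) (Fin 2) k)).prod =
      !![∏ j, (th j : k), ∑ j, (∏ i ∈ Finset.univ.filter (· < j), (th i : k)) * c j *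
          (∏ i ∈ Finset.univ.filter (j < ·), (th i : k))⁻¹; 0, (∏ j, (th j : k))⁻¹] := by
  induction s with
  | zero => simp [Matrix.one_fin_two]
  | succ n ih =>
    rw [List.ofFn_succ, List.prod_cons, ih]
    simp [Finset.prod_filter, Fin.sum_univ_succ, Fin.prod_univ_succ, Finset.mul_sum,
      mul_assoc, mul_comm, mul_left_comm, add_comm]


/-- For upper-triangular matrices `A_i = !![λ_i, α_i; 0, λ_i⁻¹]`,
`B_i = !![μ_i, β_i; 0, μ_i⁻¹]` and `P_k = !![ϑ_k, c_k; 0, ϑ_k⁻¹]` in `SL₂(k)`, the relation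
`∏ [A_i,B_i] · ∏ P_k = 1` holds if and only if `∏ ϑ_k = 1` and
`Σ_i (μ_i β_i (λ_i²−1) + λ_i α_i (1−μ_i²)) + Σ_k (∏_{j<k} ϑ_j) c_k (∏_{j>k} ϑ_j)⁻¹ = 0`. -/
theorem prod_commutators_mul_prod_parabolic_eq_one_iff (k : Type*) [Field k] (g s : ℕ)
    (lam mu : Fin g → kˣ) (al be : Fin g → k) (th : Fin s → kˣ) (c : Fin s → k) :
    ((List.ofFn fun i : Fin g =>
        (!![(lam i : k), al i; 0, ((lam i)⁻¹ : kˣ)] * !![(mu i : k), be i; 0, ((mu i)⁻¹ : kˣ)] *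
          (!![(lam i : k), al i; 0, ((lam i)⁻¹ : kˣ)])⁻¹ *
          (!![(mu i : k), be i; 0, ((mu i)⁻¹ : kˣ)])⁻¹ : Matrix (Fin 2) (Fin 2) k)).prod *
      (List.ofFn fun j : Fin s =>
        (!![(th j : k), c j; 0, ((th j)⁻¹ : kˣ)] : Matrix (Fin 2) (Fin 2) k)).prod = 1) ↔
    ((∏ j : Fin s, (th j : k)) = 1 ∧
      (∑ i : Fin g,
          ((mu i : k) * be i * ((lam i : k) ^ 2 - 1) + (lam i : k) * al i * (1 - (mu i : k) ^ 2)))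
        + ∑ j : Fin s, (∏ i ∈ Finset.univ.filter (· < j), (th i : k)) * c j *
            (∏ i ∈ Finset.univ.filter (j < ·), (th i : k))⁻¹ = 0) := by
  simp only [commutator_upperTriangular]
  rw [prod_ofFn_unipotent, prod_ofFn_upperTriangular, Matrix.mul_fin_two, Matrix.one_fin_two]
  simp only [one_mul, zero_mul, mul_zero, add_zero, zero_add]
  constructor
  · intro h
    have hth := congrFun (congrFun h 0) 0
    have hsum := congrFun (congrFun h 0) 1
    simp only [Matrix.of_apply, Matrix.cons_val_zero, Matrix.cons_val_one] at hth hsum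
    refine ⟨hth, ?_⟩
    rwa [hth, inv_one, mul_one, add_comm] at hsum
  · rintro ⟨hth, hsum⟩
    rw [hth, inv_one, mul_one, add_comm, hsum]
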